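/- Let A be a commutative ring and suppose there exists an integer n whose image in A is a unit and such that n⁴ − 1 is also a unit in A. Let a, b ∈ A^× and let λ, μ ∈ A^× be units with λ² − 1 ∈ A^× and μ² − 1 ∈ A^×. Then the 2-cycles F(a,b)_λ and F(a,b)_μ represent the same homology class in H₂(SL₂(A), ℤ); i.e. the class C(a,b)_λ is independent of the choice of λ. -/

import Mathlib

noncomputable section

variable {A : Type*} [CommRing A]

/-- The elementary matrix `E₁₂(x) = (1, x; 0, 1)` in `SL₂(A)`. -/
def E12 (x : A) : Matrix.SpecialLinearGroup (Fin 2) A :=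
  ⟨!![1, x; 0, 1], by simp [Matrix.det_fin_two_of]⟩

/-- The elementary matrix `E₂₁(y) = (1, 0; y, 1)` in `SL₂(A)`. -/
def E21 (y : A) : Matrix.SpecialLinearGroup (Fin 2) A :=
  ⟨!![1, 0; y, 1], by simp [Matrix.det_fin_two_of]⟩

/-- The diagonal matrix `D(u) = (u, 0; 0, u⁻¹)` in `SL₂(A)`. -/
def Dm (u : Aˣ) : Matrix.SpecialLinearGroup (Fin 2) A :=
  ⟨!![(u : A), 0; 0, ((u⁻¹ : Aˣ) : A)], by simp [Matrix.det_fin_two_of]⟩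

/-- The matrix `w = (0, 1; -1, 0)` in `SL₂(A)`. -/
def wm : Matrix.SpecialLinearGroup (Fin 2) A :=
  ⟨!![0, 1; -1, 0], by norm_num [Matrix.det_fin_two_of]⟩

/-- The matrix `G_a = (0, -1; 1, a + a⁻¹)` in `SL₂(A)`. -/
def Gm (a : Aˣ) : Matrix.SpecialLinearGroup (Fin 2) A :=
  ⟨!![0, -1; 1, (a : A) + ((a⁻¹ : Aˣ) : A)], by norm_num [Matrix.det_fin_two_of]⟩

/-- The matrix `H_a = E₂₁(a)`. -/
def Hm (a : Aˣ) : Matrix.SpecialLinearGroup (Fin 2) A :=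
  E21 (a : A)

/-- The matrix `R_a = H_a G_a H_a⁻¹ = (a, -1; 0, a⁻¹)`. -/
def Rm (a : Aˣ) : Matrix.SpecialLinearGroup (Fin 2) A :=
  Hm a * Gm a * (Hm a)⁻¹

/-- Degree-2 bar chains of `G` with trivial `ℤ` coefficients; `[g|h]` is `single (g, h) 1`. -/
abbrev barC2 (G : Type*) := (G × G) →₀ ℤ

/-- Degree-2 differential of the bar complex of `G` with trivial `ℤ` coefficients:
`d₂([g|h]) = [h] - [gh] + [g]`. -/
def barD2 (G : Type*) [Group G] : ((G × G) →₀ ℤ) →ₗ[ℤ] (G →₀ ℤ) :=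
  Finsupp.lsum ℤ fun p => LinearMap.toSpanSingleton ℤ _
    (Finsupp.single p.2 1 - Finsupp.single (p.1 * p.2) 1 + Finsupp.single p.1 1)

/-- The 2-chain `Θ_a = [H_a|G_a] - [R_a|H_a] + [w⁻¹|wG_a]`. -/
def Theta (a : Aˣ) : barC2 (Matrix.SpecialLinearGroup (Fin 2) A) :=
  Finsupp.single (Hm a, Gm a) 1 - Finsupp.single (Rm a, Hm a) 1 +
    Finsupp.single (wm⁻¹, wm * Gm a) 1

/-- The 2-chain `Ψ_{x,λ} = [E₁₂(x)|E₁₂(x′)D(λ)] - [D(λ)|E₁₂(x′)] + [E₁₂(x′)|D(λ)]`, where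
`x′ = x/(λ² - 1)`. -/
def Psi (lam : Aˣ) (x : A) : barC2 (Matrix.SpecialLinearGroup (Fin 2) A) :=
  Finsupp.single (E12 x, E12 (Ring.inverse ((lam : A) ^ 2 - 1) * x) * Dm lam) 1 -
    Finsupp.single (Dm lam, E12 (Ring.inverse ((lam : A) ^ 2 - 1) * x)) 1 +
    Finsupp.single (E12 (Ring.inverse ((lam : A) ^ 2 - 1) * x), Dm lam) 1

/-- The 2-chain `F(a,b)_λ` of Proposition 7.1 (`prop:fab`). -/
def Fc (a b lam : Aˣ) : barC2 (Matrix.SpecialLinearGroup (Fin 2) A) :=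
  Finsupp.single (Rm a, Rm b) 1 +
    Finsupp.single (Rm a * Rm b, (Rm a * Rm b)⁻¹ * Rm (a * b)) 1 +
    Theta a + Theta b - Theta (a * b) - Theta 1 +
    Psi lam (((a * b : Aˣ) : A) + (((a * b)⁻¹ : Aˣ) : A)) -
    Psi lam ((a : A) + ((a⁻¹ : Aˣ) : A)) -
    Psi lam ((b : A) + ((b⁻¹ : Aˣ) : A)) +
    Psi lam 2 - Psi lam (-1) +
    Psi lam ((((a * b)⁻¹ : Aˣ) : A) * ((a : A) + ((b⁻¹ : Aˣ) : A) - 1))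

/-- Degree-3 differential of the bar complex of `G` with trivial `ℤ` coefficients:
`d₃([g|h|k]) = [h|k] - [gh|k] + [g|hk] - [g|h]`. -/
def barD3 (G : Type*) [Group G] : ((G × G × G) →₀ ℤ) →ₗ[ℤ] ((G × G) →₀ ℤ) :=
  Finsupp.lsum ℤ fun t => LinearMap.toSpanSingleton ℤ _
    (Finsupp.single (t.2.1, t.2.2) 1 - Finsupp.single (t.1 * t.2.1, t.2.2) 1 +
      Finsupp.single (t.1, t.2.1 * t.2.2) 1 - Finsupp.single (t.1, t.2.1) 1)

/-- A `2`-cocycle on `G` with values in the trivial module `M`. -/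
def IsTwoCocycle {G M : Type*} [Group G] [AddCommGroup M] (f : G → G → M) : Prop :=
  ∀ g h k, f h k + f g (h * k) = f (g * h) k + f g h

/-- The underlying type of the central extension of `G` by `M` attached to the cocycle `f`. -/
@[ext]
structure CocycleExt {G M : Type*} [Group G] [AddCommGroup M] {f : G → G → M}
    (hf : IsTwoCocycle f) where
  /-- The component in the quotient `G`. -/
  base : G
  /-- The component in the central subgroup `M`. -/
  fiber : M

namespace CocycleExt

variable {G M : Type*} [Group G] [AddCommGroup M] {f : G → G → M} {hf : IsTwoCocycle f}

instance : Mul (CocycleExt hf) :=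
  ⟨fun a b => ⟨a.base * b.base, a.fiber + b.fiber + f a.base b.base⟩⟩

instance : One (CocycleExt hf) := ⟨⟨1, -f 1 1⟩⟩

instance : Inv (CocycleExt hf) :=
  ⟨fun a => ⟨a.base⁻¹, -a.fiber - f a.base⁻¹ a.base - f 1 1⟩⟩

lemma base_mul (a b : CocycleExt hf) : (a * b).base = a.base * b.base := rfl

lemma fiber_mul (a b : CocycleExt hf) :
    (a * b).fiber = a.fiber + b.fiber + f a.base b.base := rfl

lemma base_one : (1 : CocycleExt hf).base = 1 := rfl

lemma fiber_one : (1 : CocycleExt hf).fiber = -f 1 1 := rfl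

lemma base_inv (a : CocycleExt hf) : a⁻¹.base = a.base⁻¹ := rfl

lemma fiber_inv (a : CocycleExt hf) :
    a⁻¹.fiber = -a.fiber - f a.base⁻¹ a.base - f 1 1 := rfl

lemma cocycle_one_left (hf : IsTwoCocycle f) (g : G) : f 1 g = f 1 1 := by
  have h := hf 1 1 g
  rw [one_mul, one_mul] at h
  exact add_left_cancel h

lemma cocycle_one_right (hf : IsTwoCocycle f) (g : G) : f g 1 = f 1 1 := by
  have h := hf g 1 1
  rw [mul_one, mul_one] at h
  exact (add_right_cancel (h.trans (add_comm _ _))).symm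

instance : Group (CocycleExt hf) :=
  Group.ofLeftAxioms
    (fun a b c => by
      ext
      · simp only [base_mul, mul_assoc]
      · have h := hf a.base b.base c.base
        simp only [base_mul, fiber_mul]
        calc a.fiber + b.fiber + f a.base b.base + c.fiber + f (a.base * b.base) c.base
            = a.fiber + b.fiber + c.fiber + (f (a.base * b.base) c.base + f a.base b.base) := by
              abel
          _ = a.fiber + (b.fiber + c.fiber + f b.base c.base) +
                f a.base (b.base * c.base) := by
              rw [← h]
              abel)
    (fun a => by
      ext
      · simp only [base_mul, base_one, one_mul]
      · simp only [fiber_mul, fiber_one, base_one, cocycle_one_left hf a.base]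
        abel)
    (fun a => by
      ext
      · simp only [base_mul, base_inv, base_one, inv_mul_cancel]
      · simp only [fiber_mul, fiber_inv, base_inv, fiber_one]
        abel)

/-- The projection of the extension onto `G`. -/
def proj (hf : IsTwoCocycle f) : CocycleExt hf →* G where
  toFun := base
  map_one' := rfl
  map_mul' _ _ := rfl

lemma ker_proj_le_center : (proj hf).ker ≤ Subgroup.center (CocycleExt hf) := by
  intro z hz
  have hz : z.base = 1 := hz
  rw [Subgroup.mem_center_iff]
  intro a
  ext
  · simp only [base_mul, hz, one_mul, mul_one]
  · simp only [fiber_mul, hz, cocycle_one_left hf a.base,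
      cocycle_one_right hf a.base, add_comm a.fiber]

end CocycleExt

section CentralExtension

open scoped MatrixGroups commutatorElement

variable {Γ G : Type*} [Group Γ] [Group G] {p : Γ →* G}

lemma exists_eq_mul_of_ker_le_center (hp : p.ker ≤ Subgroup.center Γ) {a a' : Γ}
    (h : p a = p a') : ∃ z ∈ Subgroup.center Γ, a = a' * z :=
  ⟨a'⁻¹ * a, hp (by rw [MonoidHom.mem_ker, map_mul, map_inv, h, inv_mul_cancel]), by group⟩

lemma commutatorElement_congr (hp : p.ker ≤ Subgroup.center Γ) {a a' b b' : Γ}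
    (ha : p a = p a') (hb : p b = p b') : ⁅a, b⁆ = ⁅a', b'⁆ := by
  obtain ⟨y, hy, rfl⟩ := exists_eq_mul_of_ker_le_center hp ha
  obtain ⟨z, hz, rfl⟩ := exists_eq_mul_of_ker_le_center hp hb
  rw [Subgroup.mem_center_iff] at hy hz
  have h : a' * y * (b' * z) = a' * b' * (y * z) := by
    rw [mul_assoc, ← mul_assoc y, ← hy b']
    group
  have h' : b' * z * (a' * y) = b' * a' * (y * z) := by
    rw [mul_assoc, ← mul_assoc z, ← hz a', hz y]
    group
  have key (g k : Γ) : ⁅g, k⁆ = g * k * (k * g)⁻¹ := by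
    rw [commutatorElement_def]
    group
  rw [key, h, h', key]
  group

lemma E12_mul (x y : A) : E12 x * E12 y = E12 (x + y) := by
  ext i j
  simp only [Matrix.SpecialLinearGroup.coe_mul]
  fin_cases i <;> fin_cases j <;> simp [E12, Matrix.mul_apply, Fin.sum_univ_two, add_comm]

lemma E12_zero : E12 (0 : A) = 1 := by
  ext i j
  fin_cases i <;> fin_cases j <;> simp [E12]

lemma E12_inv (x : A) : (E12 x)⁻¹ = E12 (-x) :=
  inv_eq_of_mul_eq_one_right (by rw [E12_mul, add_neg_cancel, E12_zero])

lemma Dm_mul_E12 (u : Aˣ) (x : A) : Dm u * E12 x = E12 ((u : A) ^ 2 * x) * Dm u := by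
  ext i j
  simp only [Matrix.SpecialLinearGroup.coe_mul]
  fin_cases i <;> fin_cases j <;>
    simp [E12, Dm, Matrix.mul_apply, Fin.sum_univ_two]
  linear_combination -((u : A) * x) * u.mul_inv

lemma Dm_mul_comm (u v : Aˣ) : Dm u * Dm v = Dm v * Dm u := by
  ext i j
  simp only [Matrix.SpecialLinearGroup.coe_mul]
  fin_cases i <;> fin_cases j <;>
    simp [Dm, Matrix.mul_apply, Fin.sum_univ_two, mul_comm]

lemma Dm_conj_E12 (u : Aˣ) (x : A) : Dm u * E12 x * (Dm u)⁻¹ = E12 ((u : A) ^ 2 * x) := by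
  rw [Dm_mul_E12, mul_inv_cancel_right]

lemma commutatorElement_Dm_E12 (u : Aˣ) (x : A) :
    ⁅Dm u, E12 x⁆ = E12 (((u : A) ^ 2 - 1) * x) := by
  rw [commutatorElement_def, Dm_conj_E12, E12_inv, E12_mul]
  congr 1
  ring

variable {p : Γ →* SL(2, A)}

/-- In a central extension of `SL₂(A)`, commutators of lifts of elementary matrices are
additive in the first argument. -/
lemma commutatorElement_add (hp : p.ker ≤ Subgroup.center Γ) {g h k l : Γ} {x y z : A}
    (hg : p g = E12 x) (hh : p h = E12 y) (hk : p k = E12 (x + y)) (hl : p l = E12 z) :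
    ⁅k, l⁆ = ⁅g, l⁆ * ⁅h, l⁆ := by
  have hc : ⁅h, l⁆ ∈ Subgroup.center Γ := hp <| by
    rw [MonoidHom.mem_ker, map_commutatorElement, hh, hl,
      commutatorElement_eq_one_iff_mul_comm, E12_mul, E12_mul, add_comm]
  rw [commutatorElement_congr hp (a' := g * h) (b' := l)
    (by rw [hk, map_mul, hg, hh, E12_mul]) rfl, commutatorElement_mul_left_eq_conj_mul,
    Subgroup.mem_center_iff.mp hc g, mul_inv_cancel_right]
  rw [← Subgroup.mem_center_iff.mp hc]

/-- The commutator of lifts, as a homomorphism in the first elementary matrix. -/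
def commutatorHom (hp : p.ker ≤ Subgroup.center Γ) (hs : Function.Surjective p) (y : A) :
    Multiplicative A →* Γ :=
  MonoidHom.mk' (fun x => ⁅Function.surjInv hs (E12 x.toAdd), Function.surjInv hs (E12 y)⁆)
    fun _ _ => commutatorElement_add hp (Function.surjInv_eq hs _) (Function.surjInv_eq hs _)
      (Function.surjInv_eq hs _) (Function.surjInv_eq hs _)

lemma commutatorHom_eq (hp : p.ker ≤ Subgroup.center Γ) (hs : Function.Surjective p)
    {x y : A} {g h : Γ} (hg : p g = E12 x) (hh : p h = E12 y) :
    commutatorHom hp hs y (.ofAdd x) = ⁅g, h⁆ :=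
  commutatorElement_congr hp ((Function.surjInv_eq hs _).trans hg.symm)
    ((Function.surjInv_eq hs _).trans hh.symm)

lemma commutatorHom_swap (hp : p.ker ≤ Subgroup.center Γ) (hs : Function.Surjective p)
    (x y : A) :
    commutatorHom hp hs y (.ofAdd x) = (commutatorHom hp hs x (.ofAdd y))⁻¹ :=
  (commutatorElement_inv _ _).symm

lemma commutatorHom_int_mul_left (hp : p.ker ≤ Subgroup.center Γ) (hs : Function.Surjective p)
    (m : ℤ) (x y : A) :
    commutatorHom hp hs y (.ofAdd (m * x)) = commutatorHom hp hs y (.ofAdd x) ^ m := by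
  rw [← zsmul_eq_mul, ofAdd_zsmul, map_zpow]

lemma commutatorHom_int_mul_right (hp : p.ker ≤ Subgroup.center Γ)
    (hs : Function.Surjective p) (m : ℤ) (x y : A) :
    commutatorHom hp hs (m * y) (.ofAdd x) = commutatorHom hp hs y (.ofAdd x) ^ m := by
  rw [commutatorHom_swap, commutatorHom_int_mul_left, ← inv_zpow, ← commutatorHom_swap]

lemma commutatorHom_mul_sq (hp : p.ker ≤ Subgroup.center Γ) (hs : Function.Surjective p)
    (u : Aˣ) (x y : A) :
    commutatorHom hp hs ((u : A) ^ 2 * y) (.ofAdd ((u : A) ^ 2 * x)) =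
      commutatorHom hp hs y (.ofAdd x) := by
  obtain ⟨d, hd⟩ := hs (Dm u)
  obtain ⟨g, hg⟩ := hs (E12 x)
  obtain ⟨h, hh⟩ := hs (E12 y)
  have hc : ⁅g, h⁆ ∈ Subgroup.center Γ := hp <| by
    rw [MonoidHom.mem_ker, map_commutatorElement, hg, hh,
      commutatorElement_eq_one_iff_mul_comm, E12_mul, E12_mul, add_comm]
  rw [commutatorHom_eq hp hs hg hh,
    commutatorHom_eq hp hs (g := d * g * d⁻¹) (h := d * h * d⁻¹)
      (by rw [map_mul, map_mul, map_inv, hd, hg, Dm_conj_E12])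
      (by rw [map_mul, map_mul, map_inv, hd, hh, Dm_conj_E12]),
    ← conjugate_commutatorElement, Subgroup.mem_center_iff.mp hc, mul_inv_cancel_right]

/-- If `n` and `n⁴ - 1` are units of `A`, lifts of elementary matrices `E₁₂` to a central
extension of `SL₂(A)` commute. -/
lemma commute_of_map_eq_E12 (hp : p.ker ≤ Subgroup.center Γ) (hs : Function.Surjective p)
    {n : ℤ} (hn : IsUnit (n : A)) (hn4 : IsUnit ((n : A) ^ 4 - 1)) {g h : Γ} {x y : A}
    (hg : p g = E12 x) (hh : p h = E12 y) : Commute g h := by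
  obtain ⟨u, hu⟩ := hn
  obtain ⟨z, rfl⟩ : ∃ z, x = ((n ^ 4 - 1 : ℤ) : A) * z :=
    ⟨Ring.inverse ((n : A) ^ 4 - 1) * x, by
      push_cast
      rw [Ring.mul_inverse_cancel_left _ _ hn4]⟩
  have h4 : commutatorHom hp hs y (.ofAdd z) ^ n ^ 4 = commutatorHom hp hs y (.ofAdd z) := by
    have := commutatorHom_mul_sq hp hs u z y
    rw [hu, ← Int.cast_pow, commutatorHom_int_mul_left, commutatorHom_int_mul_right,
      ← zpow_mul] at this
    rwa [show n ^ 4 = n ^ 2 * n ^ 2 by ring]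
  rw [← commutatorElement_eq_one_iff_commute, ← commutatorHom_eq hp hs hg hh,
    commutatorHom_int_mul_left, zpow_sub_one, h4, mul_inv_cancel]

/-- In a central extension of `SL₂(A)`, the lift of `E₁₂(x)` given by the commutator of lifts
of `D(λ)` and `E₁₂(x / (λ² - 1))` does not depend on `λ`. -/
lemma commutatorElement_lift_eq (hp : p.ker ≤ Subgroup.center Γ) (hs : Function.Surjective p)
    {n : ℤ} (hn : IsUnit (n : A)) (hn4 : IsUnit ((n : A) ^ 4 - 1)) {lam mu : Aˣ} (x : A)
    {d d' e e' : Γ} (hd : p d = Dm lam) (hd' : p d' = Dm mu)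
    (he : p e = E12 (((mu : A) ^ 2 - 1) * x)) (he' : p e' = E12 (((lam : A) ^ 2 - 1) * x)) :
    ⁅d, e⁆ = ⁅d', e'⁆ := by
  obtain ⟨g, hg⟩ := hs (E12 x)
  have hconj {k : Γ} {u : Aˣ} {y : A} {l : Γ} (hk : p k = Dm u) (hl : p l = E12 y) :
      p (k * l * k⁻¹) = E12 ((u : A) ^ 2 * y) := by
    rw [map_mul, map_mul, map_inv, hk, hl, Dm_conj_E12]
  have comm {k l : Γ} {y z : A} (hk : p k = E12 y) (hl : p l = E12 z) : Commute k l :=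
    commute_of_map_eq_E12 hp hs hn hn4 hk hl
  have expand (k l : Γ) :
      ⁅k, ⁅l, g⁆⁆ = k * (l * g * l⁻¹) * k⁻¹ * (k * g * k⁻¹)⁻¹ * (g * (l * g * l⁻¹)⁻¹) := by
    simp only [commutatorElement_def]
    group
  have hdd : d * (d' * g * d'⁻¹) * d⁻¹ = d' * (d * g * d⁻¹) * d'⁻¹ := by
    have hc : ⁅d, d'⁆ ∈ Subgroup.center Γ := hp <| by
      rw [MonoidHom.mem_ker, map_commutatorElement, hd, hd',
        commutatorElement_eq_one_iff_mul_comm, Dm_mul_comm]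
    calc d * (d' * g * d'⁻¹) * d⁻¹
        = ⁅d, d'⁆ * (d' * (d * g * d⁻¹) * d'⁻¹) * ⁅d, d'⁆⁻¹ := by
          rw [commutatorElement_def]
          group
      _ = d' * (d * g * d⁻¹) * d'⁻¹ := by
          rw [← Subgroup.mem_center_iff.mp hc, mul_inv_cancel_right]
  rw [commutatorElement_congr hp (a' := d) (b' := ⁅d', g⁆) rfl
      (by rw [he, map_commutatorElement, hd', hg, commutatorElement_Dm_E12]),
    commutatorElement_congr hp (a := d') (b := e') (b' := ⁅d, g⁆) rfl
      (by rw [he', map_commutatorElement, hd, hg, commutatorElement_Dm_E12]),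
    expand d d', expand d' d, hdd, mul_assoc _ (_⁻¹) (g * _),
    mul_assoc _ (_⁻¹) (g * _)]
  congr 1
  have h₁ : Commute (d * g * d⁻¹)⁻¹ (g * (d' * g * d'⁻¹)⁻¹) :=
    ((comm (hconj hd hg) hg).mul_right (comm (hconj hd hg) (hconj hd' hg)).inv_right).inv_left
  have h₂ : Commute g (d' * g * d'⁻¹)⁻¹ := (comm hg (hconj hd' hg)).inv_right
  rw [h₁.eq, h₂.eq, mul_assoc]

end CentralExtension

section BarComplex

open scoped MatrixGroups commutatorElement

lemma isTwoCocycle_mkQ_single (G : Type*) [Group G] :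
    IsTwoCocycle fun g h : G =>
      (LinearMap.range (barD3 G)).mkQ (Finsupp.single (g, h) 1) := by
  intro g h k
  have hd : barD3 G (Finsupp.single (g, h, k) 1) = Finsupp.single (h, k) 1 -
      Finsupp.single (g * h, k) 1 + Finsupp.single (g, h * k) 1 - Finsupp.single (g, h) 1 := by
    simp [barD3]
  have hz : (LinearMap.range (barD3 G)).mkQ (barD3 G (Finsupp.single (g, h, k) 1)) = 0 := by
    rw [Submodule.mkQ_apply, Submodule.Quotient.mk_eq_zero]
    exact LinearMap.mem_range_self _ _
  rw [hd, map_sub, map_add, map_sub] at hz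
  rw [← sub_eq_zero, ← hz]
  abel

lemma mkQ_Psi {lam : Aˣ} (hlam : IsUnit ((lam : A) ^ 2 - 1)) (x : A)
    {d e : CocycleExt (isTwoCocycle_mkQ_single SL(2, A))}
    (hd : d = ⟨Dm lam, 0⟩) (he : e = ⟨E12 (Ring.inverse ((lam : A) ^ 2 - 1) * x), 0⟩) :
    (LinearMap.range (barD3 SL(2, A))).mkQ (Psi lam x) = -⁅d, e⁆.fiber := by
  have hb : ⁅d, e⁆.base = E12 x := by
    change CocycleExt.proj _ ⁅d, e⁆ = _
    rw [map_commutatorElement, hd, he]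
    change ⁅Dm lam, E12 (Ring.inverse ((lam : A) ^ 2 - 1) * x)⁆ = _
    rw [commutatorElement_Dm_E12, Ring.mul_inverse_cancel_left _ _ hlam]
  have h : (d * e).fiber = (⁅d, e⁆ * (e * d)).fiber := by
    rw [commutatorElement_def]
    group
  rw [CocycleExt.fiber_mul, CocycleExt.fiber_mul, CocycleExt.fiber_mul, hb,
    CocycleExt.base_mul] at h
  generalize ⁅d, e⁆.fiber = c at h ⊢
  subst hd he
  simp only [zero_add] at h
  rw [Psi, map_add, map_sub, h]
  abel

/-- The class of `Ψ_{x,λ}` modulo boundaries is independent of `λ`. -/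
lemma Psi_sub_Psi_mem_range {n : ℤ} (hn : IsUnit (n : A)) (hn4 : IsUnit ((n : A) ^ 4 - 1))
    {lam mu : Aˣ} (hlam : IsUnit ((lam : A) ^ 2 - 1)) (hmu : IsUnit ((mu : A) ^ 2 - 1)) (x : A) :
    Psi lam x - Psi mu x ∈ LinearMap.range (barD3 SL(2, A)) := by
  rw [← Submodule.Quotient.mk_eq_zero, ← Submodule.mkQ_apply, map_sub, sub_eq_zero,
    mkQ_Psi hlam x rfl rfl, mkQ_Psi hmu x rfl rfl]
  refine congrArg (fun c => -CocycleExt.fiber c) <|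
    commutatorElement_lift_eq CocycleExt.ker_proj_le_center (fun g => ⟨⟨g, 0⟩, rfl⟩) hn hn4
      (Ring.inverse ((lam : A) ^ 2 - 1) * (Ring.inverse ((mu : A) ^ 2 - 1) * x))
      rfl rfl ?_ ?_
  · rw [mul_left_comm (Ring.inverse _) (Ring.inverse _), Ring.mul_inverse_cancel_left _ _ hmu]
    rfl
  · rw [Ring.mul_inverse_cancel_left _ _ hlam]
    rfl

end BarComplex

/-- if `A` contains the image of an integer `n` as a unit with `n⁴ − 1` also a
unit, then for units `a, b` and units `λ, μ` with `λ² − 1, μ² − 1` units, the 2-cycles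
`F(a,b)_λ` and `F(a,b)_μ` differ by a boundary, i.e. they represent the same homology class
in `H₂(SL₂(A), ℤ)`: the class `C(a,b)_λ` is independent of the choice of `λ`. -/
theorem stmt18 (A : Type*) [CommRing A] (n : ℤ) (hn : IsUnit ((n : A)))
    (hn4 : IsUnit ((n : A) ^ 4 - 1)) (a b : Aˣ) (lam mu : Aˣ)
    (hlam : IsUnit ((lam : A) ^ 2 - 1)) (hmu : IsUnit ((mu : A) ^ 2 - 1)) :
    Fc a b lam - Fc a b mu ∈
      LinearMap.range (barD3 (Matrix.SpecialLinearGroup (Fin 2) A)) := by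
  have key := Psi_sub_Psi_mem_range hn hn4 hlam hmu
  have h := add_mem (sub_mem (add_mem (sub_mem (sub_mem
    (key (((a * b : Aˣ) : A) + (((a * b)⁻¹ : Aˣ) : A)))
    (key ((a : A) + ((a⁻¹ : Aˣ) : A)))) (key ((b : A) + ((b⁻¹ : Aˣ) : A)))) (key 2)) (key (-1)))
    (key ((((a * b)⁻¹ : Aˣ) : A) * ((a : A) + ((b⁻¹ : Aˣ) : A) - 1)))
  convert h using 1
  rw [Fc, Fc]
  abel
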